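/- For every f ∈ F, the left ideal R·f(c) is the annihilator of the left R-module R ⧸ Submodule.span R {f(c)}: for every r ∈ R, one has (r * s ∈ Submodule.span R {f(c)} for all s ∈ R) if and only if r ∈ Submodule.span R {f(c)}. In particular, the left ideal Submodule.span R {f(c)} is a two-sided ideal of R. -/

import Mathlib

noncomputable section

/-- The defining relation `X * Y = 1` of the Jacobson algebra. -/
inductive JRel (K : Type*) [Field K] : FreeAlgebra K (Fin 2) → FreeAlgebra K (Fin 2) → Prop
  | rel : JRel K (FreeAlgebra.ι K 0 * FreeAlgebra.ι K 1) 1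

/-- The Jacobson algebra `K⟨X, Y | XY = 1⟩`. -/
abbrev Jacobson (K : Type*) [Field K] := RingQuot (JRel K)

variable (K : Type*) [Field K]

/-- The generator `X` of the Jacobson algebra. -/
def Xg : Jacobson K := RingQuot.mkAlgHom K (JRel K) (FreeAlgebra.ι K 0)

/-- The generator `Y` of the Jacobson algebra. -/
def Yg : Jacobson K := RingQuot.mkAlgHom K (JRel K) (FreeAlgebra.ι K 1)

/-- The loop `c = Y²X`. -/
def cJ : Jacobson K := Yg K ^ 2 * Xg K

/-- `F` is the set of irreducible polynomials `f ∈ K[x]` with `f(0) = -1`. -/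
def FSet : Set (Polynomial K) := {f | Irreducible f ∧ f.eval 0 = -1}

theorem XY_one : Xg K * Yg K = 1 := by
  have h := RingQuot.mkAlgHom_rel K (JRel.rel (K := K))
  simpa [Xg, Yg] using h

theorem aeval_c (p : Polynomial K) :
    Polynomial.aeval (cJ K) p =
      p.eval 0 • (1 - Yg K * Xg K) + Polynomial.aeval (Yg K) p * (Yg K * Xg K) := by
  have hc : ∀ n : ℕ, cJ K ^ (n + 1) = Yg K ^ (n + 1) * (Yg K * Xg K) := by
    intro n
    induction n with
    | zero => simp [cJ, pow_two, mul_assoc]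
    | succ n ih =>
      rw [pow_succ, ih]
      calc Yg K ^ (n + 1) * (Yg K * Xg K) * cJ K
          = Yg K ^ (n + 1) * Yg K * (Xg K * Yg K) * (Yg K * Xg K) := by
            simp only [cJ, pow_two, mul_assoc]
        _ = _ := by rw [XY_one, mul_one, ← pow_succ]
  induction p using Polynomial.induction_on' with
  | add p q hp hq => simp only [map_add, hp, hq, Polynomial.eval_add, add_smul, add_mul]; abel
  | monomial n a =>
    cases n with
    | zero =>
      simp [Polynomial.aeval_monomial, Algebra.algebraMap_eq_smul_one, ← smul_add]
    | succ n => simp [Polynomial.aeval_monomial, hc, mul_assoc]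

theorem eY_zero : (1 - Yg K * Xg K) * Yg K = 0 := by
  rw [sub_mul, mul_assoc, XY_one]; simp

theorem Xe_zero : Xg K * (1 - Yg K * Xg K) = 0 := by
  rw [mul_sub, ← mul_assoc, XY_one]; simp

theorem e_aeval (p : Polynomial K) :
    (1 - Yg K * Xg K) * Polynomial.aeval (Yg K) p = p.eval 0 • (1 - Yg K * Xg K) := by
  induction p using Polynomial.induction_on' with
  | add p q hp hq => simp only [map_add, mul_add, hp, hq, Polynomial.eval_add, add_smul]
  | monomial n a =>
    cases n with
    | zero => simp [Polynomial.aeval_monomial, Algebra.algebraMap_eq_smul_one]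
    | succ n =>
      rw [Polynomial.aeval_monomial, Algebra.algebraMap_eq_smul_one, smul_mul_assoc, one_mul,
        pow_succ', mul_smul_comm, ← mul_assoc, eY_zero]
      simp

theorem Y_comm (p : Polynomial K) :
    Polynomial.aeval (Yg K) p * Yg K = Yg K * Polynomial.aeval (Yg K) p := by
  have h := congrArg (Polynomial.aeval (Yg K)) (mul_comm p Polynomial.X)
  simpa using h

theorem X_aeval_c (p : Polynomial K) :
    Xg K * Polynomial.aeval (cJ K) p = Polynomial.aeval (Yg K) p * Xg K := by
  rw [aeval_c, mul_add, mul_smul_comm, Xe_zero, ← mul_assoc (Polynomial.aeval (Yg K) p), Y_comm,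
    ← mul_assoc, ← mul_assoc, XY_one]
  simp

theorem abstract_core {A : Type*} [Ring A] (I : Submodule A A) (u v x y e : A)
    (hxy : x * y = 1) (hvy : v * y = y * v) (he : e = 1 - y * x) (hfc : u = -e + v * (y * x))
    (hef : e * v = -e) (heY : e * y = 0) (hgen : u ∈ I) (hfX : v * x ∈ I) :
    u * x ∈ I ∧ u * y ∈ I := by
  have hl : ∀ a b : A, b ∈ I → a * b ∈ I := fun a b hb => I.smul_mem a hb
  have hYX : y * x = 1 - e := by rw [he]; abel
  have heX : e * x ∈ I := by
    have h := hl (-e) _ hfX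
    rwa [← mul_assoc, neg_mul, hef, neg_neg] at h
  have hid : e * e = e := by
    nth_rw 2 [he]
    rw [mul_sub, ← mul_assoc, heY]; simp
  have hee : e ∈ I := by
    have h := hl (-e) _ hgen
    rwa [hfc, mul_add, ← mul_assoc (-e), neg_mul_neg, neg_mul, hef, neg_neg, ← mul_assoc, heY,
      zero_mul, add_zero, hid] at h
  constructor
  · rw [hfc, hYX, add_mul, mul_sub, mul_one, sub_mul, neg_mul, mul_assoc _ e]
    exact I.add_mem (I.neg_mem heX) (I.sub_mem hfX (hl _ _ heX))
  · have h1 : u * y = y * y * (v * x) + v * y * e := by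
      have h2 : v * y * (y * x) = y * y * (v * x) := by
        rw [hvy, mul_assoc, ← mul_assoc v, hvy]; simp only [mul_assoc]
      rw [← h2, ← mul_add, hYX, sub_add_cancel, mul_one, hfc, add_mul, neg_mul, heY, mul_assoc,
        mul_assoc, hxy, mul_one, neg_zero, zero_add]
    rw [h1]
    exact I.add_mem (hl _ _ hfX) (hl _ _ hee)

theorem span_right (f : Polynomial K) (hf : f.eval 0 = -1) :
    ∀ s r : Jacobson K, r ∈ Submodule.span (Jacobson K) {Polynomial.aeval (cJ K) f} →
      r * s ∈ Submodule.span (Jacobson K) {Polynomial.aeval (cJ K) f} := by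
  set I := Submodule.span (Jacobson K) {Polynomial.aeval (cJ K) f} with hI
  have hgen : Polynomial.aeval (cJ K) f ∈ I := Submodule.mem_span_singleton_self _
  have hl : ∀ a b : Jacobson K, b ∈ I → a * b ∈ I := fun a b hb => I.smul_mem a hb
  have hfX : Polynomial.aeval (Yg K) f * Xg K ∈ I := by
    rw [← X_aeval_c]; exact hl _ _ hgen
  have hfc := aeval_c K f
  have hef := e_aeval K f
  have hneg : ∀ z : Jacobson K, (-1 : K) • z = -z := fun z => neg_one_smul K z
  rw [hf, hneg] at hfc hef
  obtain ⟨hX, hY⟩ := abstract_core I _ _ _ _ _ (XY_one K) (Y_comm K f) rfl hfc hef (eY_zero K)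
    hgen hfX
  have key : ∀ s, Polynomial.aeval (cJ K) f * s ∈ I → ∀ r ∈ I, r * s ∈ I := by
    intro s hs r hr
    obtain ⟨a, rfl⟩ := Submodule.mem_span_singleton.1 hr
    rw [smul_eq_mul, mul_assoc]
    exact hl _ _ hs
  intro s
  obtain ⟨t, rfl⟩ := RingQuot.mkAlgHom_surjective K (JRel K) s
  induction t using FreeAlgebra.induction with
  | grade0 a =>
    intro r hr
    rw [AlgHom.commutes, ← Algebra.commutes]
    exact hl _ _ hr
  | grade1 i =>
    fin_cases i
    · exact key _ hX
    · exact key _ hY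
  | mul a b ha hb =>
    intro r hr
    rw [map_mul, ← mul_assoc]
    exact hb _ (ha _ hr)
  | add a b ha hb =>
    intro r hr
    rw [map_add, mul_add]
    exact I.add_mem (ha _ hr) (hb _ hr)

/-- For every irreducible `f ∈ K[x]` with `f(0) = -1`, the left ideal `R·f(c)` is the
annihilator of the left `R`-module `R ⧸ R·f(c)`: an element `r` satisfies
`r * s ∈ R·f(c)` for all `s` iff `r ∈ R·f(c)`.  In particular, `R·f(c)` is a two-sided
ideal of `R`. -/
theorem span_fc_is_annihilator (f : Polynomial K) (hf : f ∈ FSet K) :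
    (∀ r : Jacobson K,
        (∀ s : Jacobson K,
            r * s ∈ Submodule.span (Jacobson K) {Polynomial.aeval (cJ K) f}) ↔
          r ∈ Submodule.span (Jacobson K) {Polynomial.aeval (cJ K) f}) ∧
      ∀ r ∈ Submodule.span (Jacobson K) {Polynomial.aeval (cJ K) f},
        ∀ s : Jacobson K,
          r * s ∈ Submodule.span (Jacobson K) {Polynomial.aeval (cJ K) f} := by
  have h := span_right K f hf.2
  refine ⟨fun r => ⟨fun hr => ?_, fun hr s => h s r hr⟩, fun r hr s => h s r hr⟩
  simpa using hr 1
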